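/- Let M ≥ 1 and let f : ℤ → ℂ be M-periodic. For every integer n ≥ 0, the analytic continuation of the L-function L(s, f) = Σ_{m≥1} f(m) m^{-s} satisfies L(-n, f) = -(M^n/(n+1)) Σ_{m=1}^{M} B_{n+1}(m/M) f(m), where B_{n+1} is the (n+1)-th Bernoulli polynomial. -/

import Mathlib

open Complex Set HurwitzZeta

lemma hasDerivAt_ofReal_cpow_const_of_pos {u : ℝ} (hu : 0 < u) (r : ℂ) :
    HasDerivAt (fun u : ℝ ↦ (u : ℂ) ^ r) (r * (u : ℂ) ^ (r - 1)) u := by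
  simpa using ((hasDerivAt_id (u : ℂ)).cpow_const (c := r) (by simp [hu])).comp_ofReal

/-- Lipschitz bound for `u ↦ u ^ r` to the right of `y > 0`. -/
lemma norm_cpow_sub_cpow_le {y t : ℝ} {r : ℂ} (hy : 0 < y) (ht : y ≤ t) (hr : r.re ≤ 1) :
    ‖(t : ℂ) ^ r - (y : ℂ) ^ r‖ ≤ ‖r‖ * y ^ (r.re - 1) * (t - y) := by
  have hd : ∀ u ∈ Icc y t, HasDerivWithinAt (fun u : ℝ ↦ (u : ℂ) ^ r)
      (r * (u : ℂ) ^ (r - 1)) (Icc y t) u := fun u hu ↦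
    (hasDerivAt_ofReal_cpow_const_of_pos (hy.trans_le hu.1) r).hasDerivWithinAt
  refine norm_image_sub_le_of_norm_deriv_le_segment' hd (fun u hu ↦ ?_) t ⟨ht, le_rfl⟩
  rw [norm_mul, norm_cpow_eq_rpow_re_of_pos (hy.trans_le hu.1)]
  gcongr
  exact Real.rpow_le_rpow_of_nonpos hy hu.1 (by simpa using hr)

/-- First order Taylor bound for `u ↦ u ^ r` to the right of `y > 0`. -/
lemma norm_cpow_sub_taylor_le {y t : ℝ} {r : ℂ} (hy : 0 < y) (ht : y ≤ t) (ht' : t ≤ y + 1)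
    (hr : r.re ≤ 2) :
    ‖(t : ℂ) ^ r - (y : ℂ) ^ r - (t - y) * (r * (y : ℂ) ^ (r - 1))‖ ≤
      ‖r‖ * ‖r - 1‖ * y ^ (r.re - 2) := by
  have hd : ∀ u ∈ Icc y t, HasDerivWithinAt
      (fun u : ℝ ↦ (u : ℂ) ^ r - (u : ℂ) * (r * (y : ℂ) ^ (r - 1)))
      (r * (u : ℂ) ^ (r - 1) - r * (y : ℂ) ^ (r - 1)) (Icc y t) u := fun u hu ↦ by
    have h := ((hasDerivAt_id (u : ℂ)).mul_const (r * (y : ℂ) ^ (r - 1))).comp_ofReal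
    rw [one_mul] at h
    exact ((hasDerivAt_ofReal_cpow_const_of_pos (hy.trans_le hu.1) r).sub h).hasDerivWithinAt
  have key := norm_image_sub_le_of_norm_deriv_le_segment' (C := ‖r‖ * ‖r - 1‖ * y ^ (r.re - 2))
    hd (fun u hu ↦ ?_) t ⟨ht, le_rfl⟩
  · calc _ = _ := by congr 1; ring
      _ ≤ _ := key
      _ ≤ _ := mul_le_of_le_one_right (by positivity) (by linarith)
  · have h := norm_cpow_sub_cpow_le (r := r - 1) hy hu.1 (by simp; linarith)
    rw [← mul_sub, norm_mul, mul_assoc]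
    gcongr
    refine h.trans ?_
    rw [show (r - 1).re - 1 = r.re - 2 by simp; ring]
    exact mul_le_of_le_one_right (by positivity) (by linarith [hu.2])

/-- The error of linear interpolation of `u ↦ u ^ (-s)` on `[y, y + 1]`. -/
lemma norm_cpow_sub_linear_interpolation_le {x y : ℝ} {s : ℂ} (hx : x ∈ Icc (0 : ℝ) 1)
    (hy : 0 < y) (hs : -2 ≤ s.re) :
    ‖((y + x : ℝ) : ℂ) ^ (-s) - (1 - x) * (y : ℂ) ^ (-s) - x * ((y + 1 : ℝ) : ℂ) ^ (-s)‖ ≤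
      2 * (‖s‖ * ‖s + 1‖ * y ^ (-s.re - 2)) := by
  have hr : (-s).re ≤ 2 := by simp; linarith
  have h1 := norm_cpow_sub_taylor_le (t := y + x) hy (by linarith [hx.1]) (by linarith [hx.2]) hr
  have h2 := norm_cpow_sub_taylor_le (t := y + 1) hy (by linarith) le_rfl hr
  rw [norm_neg, show -s - 1 = -(s + 1) by ring, norm_neg, neg_re] at h1 h2
  set C := ‖s‖ * ‖s + 1‖ * y ^ (-s.re - 2)
  have h3 := mul_le_mul_of_nonneg_left h2 hx.1
  rw [← Real.norm_of_nonneg hx.1, ← norm_real, ← norm_mul, norm_real,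
    Real.norm_of_nonneg hx.1] at h3
  have hC : 0 ≤ C := (norm_nonneg _).trans h2
  calc _ = _ := by
        congr 1
        push_cast
        ring
    _ ≤ _ := norm_sub_le _ _
    _ ≤ C + x * C := add_le_add h1 h3
    _ ≤ _ := by nlinarith [hx.2]

/-- The value of the Hurwitz zeta function at `s = 0`. -/
theorem hurwitzZeta_apply_zero {x : ℝ} (hx : x ∈ Ioc (0 : ℝ) 1) :
    hurwitzZeta x 0 = 1 / 2 - x := by
  have hx' : x ∈ Icc (0 : ℝ) 1 := Ioc_subset_Icc_self hx
  let g (n : ℕ) (s : ℂ) : ℂ := (((n + 1 : ℝ) + x : ℝ) : ℂ) ^ (-s) -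
    (1 - x) * ((n + 1 : ℝ) : ℂ) ^ (-s) - x * (((n + 1 : ℝ) + 1 : ℝ) : ℂ) ^ (-s)
  let U : Set ℂ := {s | -(1 / 2) < s.re} ∩ Metric.ball 0 3
  have hUo : IsOpen U := (isOpen_lt continuous_const continuous_re).inter Metric.isOpen_ball
  have hUc : IsPreconnected U :=
    ((convex_halfSpace_re_gt _).inter (convex_ball _ _)).isPreconnected
  have hbound (n : ℕ) (s : ℂ) (hs : s ∈ U) :
      ‖g n s‖ ≤ 24 * ((n + 1 : ℕ) : ℝ) ^ (-(3 / 2) : ℝ) := by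
    obtain ⟨hs1, hs2⟩ := hs
    rw [mem_ball_zero_iff] at hs2
    rw [mem_ofPred_eq] at hs1
    have hs3 : ‖s + 1‖ ≤ 4 := (norm_add_le _ _).trans (by rw [norm_one]; linarith)
    refine (norm_cpow_sub_linear_interpolation_le hx' (by positivity) (by linarith)).trans ?_
    have h : (n + 1 : ℝ) ^ (-s.re - 2) ≤ (n + 1 : ℝ) ^ (-(3 / 2) : ℝ) :=
      Real.rpow_le_rpow_of_exponent_le (by simp) (by linarith)
    calc _ ≤ 2 * (3 * 4 * (n + 1 : ℝ) ^ (-(3 / 2) : ℝ)) := by gcongr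
      _ = _ := by push_cast; ring
  have hsum : Summable fun n : ℕ ↦ 24 * ((n + 1 : ℕ) : ℝ) ^ (-(3 / 2) : ℝ) :=
    (((summable_nat_add_iff 1).mpr (Real.summable_nat_rpow.mpr (by norm_num)))).mul_left 24
  have hcpow {a : ℝ} (ha : 0 < a) : Differentiable ℂ fun s : ℂ ↦ (a : ℂ) ^ (-s) := fun s ↦
    (differentiableAt_id.neg).const_cpow (.inl (by exact_mod_cast ha.ne'))
  have hx0 := hx.1
  have hG : DifferentiableOn ℂ (fun s ↦ ∑' n, g n s) U :=
    differentiableOn_tsum_of_summable_norm hsum (fun n ↦ Differentiable.differentiableOn <|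
      ((hcpow (by positivity)).sub ((hcpow (by positivity)).const_mul _)).sub
        ((hcpow (by positivity)).const_mul _)) hUo hbound
  have hF : DifferentiableOn ℂ (fun s ↦ hurwitzZeta x s - hurwitzZeta (1 : ℝ) s -
      (x : ℂ) ^ (-s) + x) U := Differentiable.differentiableOn <|
    ((differentiable_hurwitzZeta_sub_hurwitzZeta _ _).sub (hcpow hx0)).add_const _
  have heq (s : ℂ) (hs : 1 < s.re) : hurwitzZeta x s - hurwitzZeta (1 : ℝ) s -
      (x : ℂ) ^ (-s) + x = ∑' n, g n s := by
    have h1 := (hasSum_nat_add_iff' 1).mpr (hasSum_hurwitzZeta_of_one_lt_re hx' hs)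
    have h2 := hasSum_hurwitzZeta_of_one_lt_re (a := 1) (by simp) hs
    have h3 := (hasSum_nat_add_iff' 1).mpr h2
    have h4 := ((h1.sub (h2.mul_left (1 - (x : ℂ)))).sub (h3.mul_left (x : ℂ))).tsum_eq
    calc _ = _ := by
          simp [cpow_neg]
          ring
      _ = _ := h4.symm
      _ = _ := tsum_congr fun n ↦ by simp [g, cpow_neg]
  have h2U : (2 : ℂ) ∈ U := by
    simp only [U, mem_inter_iff, mem_ofPred_eq, mem_ball_zero_iff]
    norm_num
  have h0U : (0 : ℂ) ∈ U := by
    simp only [U, mem_inter_iff, mem_ofPred_eq, mem_ball_zero_iff]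
    norm_num
  have h0 := (hF.analyticOnNhd hUo).eqOn_of_preconnected_of_eventuallyEq (hG.analyticOnNhd hUo) hUc
    h2U (Filter.eventually_of_mem ((isOpen_lt continuous_const continuous_re).mem_nhds
      (show (1 : ℝ) < (2 : ℂ).re by norm_num)) fun s hs ↦ heq s hs) h0U
  have hg0 (n : ℕ) : g n 0 = 0 := by simp [g]
  have h1 : hurwitzZeta (1 : ℝ) 0 = -1 / 2 := by
    rw [show ((1 : ℝ) : UnitAddCircle) = 0 from AddCircle.coe_period 1, hurwitzZeta_zero,
      riemannZeta_zero]
  simp only [hg0, tsum_zero, h1, neg_zero, cpow_zero] at h0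
  linear_combination h0

/-- Values of the Hurwitz zeta function at nonpositive integers. -/
theorem hurwitzZeta_neg_nat_of_mem_Ioc (n : ℕ) {x : ℝ} (hx : x ∈ Ioc (0 : ℝ) 1) :
    hurwitzZeta x (-n) =
      -1 / (n + 1) * Polynomial.aeval (x : ℂ) (Polynomial.bernoulli (n + 1)) := by
  rcases eq_or_ne n 0 with rfl | hn
  · simp [hurwitzZeta_apply_zero hx, Polynomial.bernoulli_one]
  · rw [hurwitzZeta_neg_nat hn (Ioc_subset_Icc_self hx), Polynomial.eval_map_algebraMap]

/-- Sums over `ZMod M` as sums over `{1, …, M}`. -/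
lemma ZMod.sum_eq_sum_Icc {A : Type*} [AddCommMonoid A] (M : ℕ) [NeZero M] (F : ZMod M → A) :
    ∑ j, F j = ∑ m ∈ Finset.Icc 1 M, F (m : ZMod M) := by
  have h : ∑ j, F j = ∑ m ∈ Finset.range M, F (m : ZMod M) :=
    Finset.sum_bij' (fun j _ ↦ j.val) (fun m _ ↦ (m : ZMod M))
      (fun j _ ↦ Finset.mem_range.mpr j.val_lt) (fun _ _ ↦ Finset.mem_univ _)
      (fun j _ ↦ ZMod.natCast_zmod_val j)
      (fun m hm ↦ ZMod.val_cast_of_lt (Finset.mem_range.mp hm)) (fun j _ ↦ by simp)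
  obtain ⟨k, rfl⟩ := Nat.exists_eq_succ_of_ne_zero (NeZero.ne M)
  have hIco : Finset.Ico (0 + 1) (k + 1) = Finset.Icc 1 k := by
    ext
    simp
  rw [h, Finset.sum_range_succ', Finset.sum_Icc_succ_top (by omega), Finset.range_eq_Ico,
    Finset.sum_Ico_add' (fun m : ℕ ↦ F m) 0 k 1, hIco, Nat.cast_zero, ZMod.natCast_self]


/-- Let `M ≥ 1` and `f : ℤ → ℂ` be `M`-periodic. For every `n ≥ 0`, the analytic
continuation of `L(s,f) = Σ_{m≥1} f(m) m^{-s}` (realized as `ZMod.LFunction Φ`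
for the induced function `Φ` on `ZMod M`) satisfies
`L(-n, f) = -(M^n/(n+1)) Σ_{m=1}^M B_{n+1}(m/M) f(m)`. -/
theorem stmt_5 (M : ℕ) [NeZero M] (f : ℤ → ℂ)
    (hf : ∀ m : ℤ, f (m + M) = f m)
    (Φ : ZMod M → ℂ) (hΦ : ∀ m : ℤ, Φ (m : ZMod M) = f m)
    (n : ℕ) :
    ZMod.LFunction Φ (-(n : ℂ)) =
      -((M : ℂ) ^ n / ((n : ℂ) + 1)) *
        ∑ m ∈ Finset.Icc 1 M,
          (Polynomial.aeval ((m : ℂ) / (M : ℂ)) (Polynomial.bernoulli (n + 1))) * f m := by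
  have hM : (M : ℂ) ≠ 0 := NeZero.ne _
  rw [ZMod.LFunction, neg_neg, cpow_natCast, ZMod.sum_eq_sum_Icc, Finset.mul_sum, Finset.mul_sum]
  refine Finset.sum_congr rfl fun m hm ↦ ?_
  obtain ⟨hm1, hmM⟩ := Finset.mem_Icc.mp hm
  have hM0 : (0 : ℝ) < M := by exact_mod_cast NeZero.pos M
  have hx : (m / M : ℝ) ∈ Ioc (0 : ℝ) 1 :=
    ⟨div_pos (by exact_mod_cast hm1) hM0, (div_le_one hM0).mpr (by exact_mod_cast hmM)⟩
  have hΦm : Φ (m : ZMod M) = f m := by simpa using hΦ m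
  rw [hΦm, ZMod.toAddCircle_natCast, hurwitzZeta_neg_nat_of_mem_Ioc n hx]
  push_cast
  ring
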